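/- Let H be a complex Hilbert space, A and B self-adjoint operators on H, and q = e^{−iθ₀} with 0 < |θ₀| < π. Set q^{1/2} := e^{−iθ₀/2}, so that the conjugate of q^{1/2} equals q̄^{1/2} := e^{iθ₀/2}. Fix a, b ∈ ℝ and define the operator T with domain D(T) := D_q(A,B) by Tf := q̄^{1/2}(A − a q^{1/2} I)(B − b q^{1/2} I)f + ((q̄^{1/2} − q^{1/2})/2) ab f (this is well defined since f ∈ D_q(A,B) implies f ∈ D(A) ∩ D(B) ∩ D(AB)). Then T is symmetric: ⟨Tf, g⟩ = ⟨f, Tg⟩ for all f, g ∈ D(T). -/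

import Mathlib

open scoped InnerProductSpace

/-- `R` is the (everywhere-defined bounded) resolvent of the linear partial map `T`
at the point `lam`; the existence of such an `R` means `lam ∈ ρ(T)`. -/
def IsResolventAt {H : Type*} [NormedAddCommGroup H] [InnerProductSpace ℂ H]
    (T : H →ₗ.[ℂ] H) (lam : ℂ) (R : H →L[ℂ] H) : Prop :=
  (∀ h : H, ∃ hm : R h ∈ T.domain, T ⟨R h, hm⟩ - lam • R h = h) ∧
    ∀ f : T.domain, R (T f - lam • (f : H)) = f

/-- The set `D_q(A,B)` of all `f ∈ D(AB) ∩ D(BA)` with `ABf = q • BAf`. -/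
def qCommSet {H : Type*} [NormedAddCommGroup H] [InnerProductSpace ℂ H]
    (A B : H →ₗ.[ℂ] H) (q : ℂ) : Set H :=
  {f | ∃ (hfB : f ∈ B.domain) (hfA : f ∈ A.domain)
      (hBf : B ⟨f, hfB⟩ ∈ A.domain) (hAf : A ⟨f, hfA⟩ ∈ B.domain),
      A ⟨B ⟨f, hfB⟩, hBf⟩ = q • B ⟨A ⟨f, hfA⟩, hAf⟩}

/-- The value `T f = q̄^{1/2}(A - a q^{1/2} I)(B - b q^{1/2} I) f + ((q̄^{1/2} - q^{1/2})/2) ab f`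
for `f ∈ D(A) ∩ D(B)` with `B f ∈ D(A)`; here `q^{1/2} = e^{-iθ₀/2}`, `q̄^{1/2} = e^{iθ₀/2}`
and `q = e^{-iθ₀}`. -/
noncomputable def Tval {H : Type*} [NormedAddCommGroup H] [InnerProductSpace ℂ H]
    (A B : H →ₗ.[ℂ] H) (θ₀ : ℝ) (a b : ℝ) (f : H)
    (hfB : f ∈ B.domain) (hfA : f ∈ A.domain) (hBf : B ⟨f, hfB⟩ ∈ A.domain) : H :=
  Complex.exp ((θ₀ / 2 : ℝ) * Complex.I) •
      (A ⟨B ⟨f, hfB⟩, hBf⟩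
        - ((b : ℂ) * Complex.exp (-(θ₀ / 2 : ℝ) * Complex.I)) • A ⟨f, hfA⟩
        - ((a : ℂ) * Complex.exp (-(θ₀ / 2 : ℝ) * Complex.I)) • B ⟨f, hfB⟩
        + ((a : ℂ) * (b : ℂ) * Complex.exp (-(θ₀ : ℝ) * Complex.I)) • f)
    + (((Complex.exp ((θ₀ / 2 : ℝ) * Complex.I) - Complex.exp (-(θ₀ / 2 : ℝ) * Complex.I)) / 2)
        * ((a : ℂ) * (b : ℂ))) • f

theorem symm_of_isSelfAdjoint {H : Type*} [NormedAddCommGroup H] [InnerProductSpace ℂ H]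
    [CompleteSpace H] (A : H →ₗ.[ℂ] H) (hA : IsSelfAdjoint A) (x y : A.domain) :
    ⟪A x, (y : H)⟫_ℂ = ⟪(x : H), A y⟫_ℂ := by
  have h := LinearPMap.adjoint_isFormalAdjoint hA.dense_domain
  rw [LinearPMap.isSelfAdjoint_def.mp hA] at h
  exact h x y

/-- Lemma 2.8. The operator `T` with domain `D_q(A,B)` defined by
`Tf = q̄^{1/2}(A - a q^{1/2})(B - b q^{1/2})f + ((q̄^{1/2} - q^{1/2})/2) ab f` is symmetric. -/
theorem stmt13 {H : Type*} [NormedAddCommGroup H] [InnerProductSpace ℂ H] [CompleteSpace H]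
    (A B : H →ₗ.[ℂ] H) (hA : IsSelfAdjoint A) (hB : IsSelfAdjoint B)
    (θ₀ : ℝ) (hθ₀ : 0 < |θ₀|) (hθ₀' : |θ₀| < Real.pi) (a b : ℝ) :
    ∀ f g : H, f ∈ qCommSet A B (Complex.exp (-(θ₀ : ℝ) * Complex.I)) →
      g ∈ qCommSet A B (Complex.exp (-(θ₀ : ℝ) * Complex.I)) →
      ∀ (hfB : f ∈ B.domain) (hfA : f ∈ A.domain) (hBf : B ⟨f, hfB⟩ ∈ A.domain)
        (hgB : g ∈ B.domain) (hgA : g ∈ A.domain) (hBg : B ⟨g, hgB⟩ ∈ A.domain),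
        ⟪Tval A B θ₀ a b f hfB hfA hBf, g⟫_ℂ = ⟪f, Tval A B θ₀ a b g hgB hgA hBg⟫_ℂ := by
  intro f g hf hg hfB hfA hBf hgB hgA hBg
  obtain ⟨_, _, _, hAf, hfq⟩ := hf
  obtain ⟨_, _, _, hAg, hgq⟩ := hg
  have e1 := symm_of_isSelfAdjoint A hA ⟨B ⟨f, hfB⟩, hBf⟩ ⟨g, hgA⟩
  have e2 := symm_of_isSelfAdjoint B hB ⟨f, hfB⟩ ⟨A ⟨g, hgA⟩, hAg⟩
  have e3 := symm_of_isSelfAdjoint A hA ⟨f, hfA⟩ ⟨g, hgA⟩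
  have e4 := symm_of_isSelfAdjoint B hB ⟨f, hfB⟩ ⟨g, hgB⟩
  simp only at e1 e2 e3 e4
  unfold Tval
  rw [hgq]
  have hpp : Complex.exp ((θ₀ / 2 : ℝ) * Complex.I) * Complex.exp (-(θ₀ / 2 : ℝ) * Complex.I) = 1 := by
    rw [← Complex.exp_add]; simp
  have hq : Complex.exp (-(θ₀ : ℝ) * Complex.I) = Complex.exp (-(θ₀ / 2 : ℝ) * Complex.I) ^ 2 := by
    rw [← Complex.exp_nat_mul]; congr 1; push_cast; ring
  have c1 : (starRingEnd ℂ) (Complex.exp ((θ₀ / 2 : ℝ) * Complex.I))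
      = Complex.exp (-(θ₀ / 2 : ℝ) * Complex.I) := by
    rw [← Complex.exp_conj, map_mul, Complex.conj_ofReal, Complex.conj_I]; congr 1; ring
  have c2 : (starRingEnd ℂ) (Complex.exp (-(θ₀ / 2 : ℝ) * Complex.I))
      = Complex.exp ((θ₀ / 2 : ℝ) * Complex.I) := by
    rw [← c1, Complex.conj_conj]
  rw [hq]
  generalize Complex.exp ((θ₀ / 2 : ℝ) * Complex.I) = r at *
  generalize Complex.exp (-(θ₀ / 2 : ℝ) * Complex.I) = p at *
  simp only [inner_add_left, inner_add_right, inner_sub_left, inner_sub_right, inner_smul_left,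
    inner_smul_right, map_mul, map_sub, map_pow, map_div₀, Complex.conj_ofReal, c1, c2, e1, e2, e3,
    e4, map_ofNat]
  generalize ⟪f, (B ⟨A ⟨g, hgA⟩, hAg⟩ : H)⟫_ℂ = X
  generalize ⟪f, (A ⟨g, hgA⟩ : H)⟫_ℂ = Y
  generalize ⟪f, (B ⟨g, hgB⟩ : H)⟫_ℂ = Z
  generalize ⟪f, g⟫_ℂ = W
  grind
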